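/- Let Ψ : C⊗D → D⊗C be a twist map such that Ψ' := Ψ∘τ : D⊗C → D⊗C satisfies conditions (LC1) and (LC2). Then Ψ satisfies condition (CO); in particular the twisted coproduct Δ_Ψ is coassociative. -/

import Mathlib

open TensorProduct LinearMap

noncomputable section
namespace TwistedTensor

/-- The coproduct of a coalgebra, with explicit arguments. -/
def cmul (k C : Type*) [CommSemiring k] [AddCommMonoid C] [Module k C] [Coalgebra k C] :
    C →ₗ[k] C ⊗[k] C := Coalgebra.comul

/-- The counit of a coalgebra, with explicit arguments. -/
def eps (k C : Type*) [CommSemiring k] [AddCommMonoid C] [Module k C] [Coalgebra k C] :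
    C →ₗ[k] k := Coalgebra.counit

variable {k : Type*} [Field k]
variable {C D : Type*} [AddCommGroup C] [Module k C] [AddCommGroup D] [Module k D]
  [Coalgebra k C] [Coalgebra k D]

/-- The twisted coproduct `Δ_Ψ := (id_C ⊗ Ψ ⊗ id_D) ∘ (Δ_C ⊗ Δ_D)` (with the
appropriate reassociations of tensor factors). -/
def twistedComul (Ψ : C ⊗[k] D →ₗ[k] D ⊗[k] C) :
    C ⊗[k] D →ₗ[k] (C ⊗[k] D) ⊗[k] (C ⊗[k] D) :=
  (TensorProduct.assoc k C D (C ⊗[k] D)).symm.toLinearMap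
    ∘ₗ lTensor C (TensorProduct.assoc k D C D).toLinearMap
    ∘ₗ lTensor C (rTensor D Ψ)
    ∘ₗ lTensor C (TensorProduct.assoc k C D D).symm.toLinearMap
    ∘ₗ (TensorProduct.assoc k C C (D ⊗[k] D)).toLinearMap
    ∘ₗ map (cmul k C) (cmul k D)

/-- Left-hand side of condition (CO):
`(id_D⊗id_C⊗Ψ)∘(id_D⊗Δ_C⊗id_D)∘(Ψ⊗id_D)∘(id_C⊗Δ_D)`. -/
def COlhs (Ψ : C ⊗[k] D →ₗ[k] D ⊗[k] C) :
    C ⊗[k] D →ₗ[k] D ⊗[k] (C ⊗[k] (D ⊗[k] C)) :=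
  lTensor D ((lTensor C Ψ) ∘ₗ (TensorProduct.assoc k C C D).toLinearMap)
    ∘ₗ lTensor D (rTensor D (cmul k C))
    ∘ₗ (TensorProduct.assoc k D C D).toLinearMap
    ∘ₗ rTensor D Ψ
    ∘ₗ (TensorProduct.assoc k C D D).symm.toLinearMap
    ∘ₗ lTensor C (cmul k D)

/-- Right-hand side of condition (CO):
`(Ψ⊗id_D⊗id_C)∘(id_C⊗Δ_D⊗id_C)∘(id_C⊗Ψ)∘(Δ_C⊗id_D)`. -/
def COrhs (Ψ : C ⊗[k] D →ₗ[k] D ⊗[k] C) :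
    C ⊗[k] D →ₗ[k] D ⊗[k] (C ⊗[k] (D ⊗[k] C)) :=
  (TensorProduct.assoc k D C (D ⊗[k] C)).toLinearMap
    ∘ₗ rTensor (D ⊗[k] C) Ψ
    ∘ₗ (TensorProduct.assoc k C D (D ⊗[k] C)).symm.toLinearMap
    ∘ₗ lTensor C (TensorProduct.assoc k D D C).toLinearMap
    ∘ₗ lTensor C (rTensor C (cmul k D))
    ∘ₗ lTensor C Ψ
    ∘ₗ (TensorProduct.assoc k C C D).toLinearMap
    ∘ₗ rTensor D (cmul k C)

/-- Condition (CO) on a twist map. -/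
def CondCO (Ψ : C ⊗[k] D →ₗ[k] D ⊗[k] C) : Prop := COlhs Ψ = COrhs Ψ

/-- The tensor counit `ε_⊗ = ε_C ⊗ ε_D`. -/
def tensorCounit : C ⊗[k] D →ₗ[k] k :=
  (TensorProduct.lid k k).toLinearMap ∘ₗ map (eps k C) (eps k D)

/-- `e` is a counit for the coproduct `δ` on `C ⊗ D`. -/
def IsCounit (δ : C ⊗[k] D →ₗ[k] (C ⊗[k] D) ⊗[k] (C ⊗[k] D))
    (e : C ⊗[k] D →ₗ[k] k) : Prop :=
  (TensorProduct.lid k (C ⊗[k] D)).toLinearMap ∘ₗ rTensor (C ⊗[k] D) e ∘ₗ δ = LinearMap.id ∧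
  (TensorProduct.rid k (C ⊗[k] D)).toLinearMap ∘ₗ lTensor (C ⊗[k] D) e ∘ₗ δ = LinearMap.id

/-- Right conormality: `(ε_D⊗id_C)∘Ψ = id_C⊗ε_D`. -/
def RightConormal (Ψ : C ⊗[k] D →ₗ[k] D ⊗[k] C) : Prop :=
  (TensorProduct.lid k C).toLinearMap ∘ₗ rTensor C (eps k D) ∘ₗ Ψ
    = (TensorProduct.rid k C).toLinearMap ∘ₗ lTensor C (eps k D)

/-- Left conormality: `(id_D⊗ε_C)∘Ψ = ε_C⊗id_D`. -/
def LeftConormal (Ψ : C ⊗[k] D →ₗ[k] D ⊗[k] C) : Prop :=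
  (TensorProduct.rid k D).toLinearMap ∘ₗ lTensor D (eps k C) ∘ₗ Ψ
    = (TensorProduct.lid k D).toLinearMap ∘ₗ rTensor D (eps k C)

/-- Conormality of a twist map. -/
def Conormal (Ψ : C ⊗[k] D →ₗ[k] D ⊗[k] C) : Prop :=
  RightConormal Ψ ∧ LeftConormal Ψ

/-- Condition (CP1): `(id_D⊗Ψ)∘(Ψ⊗id_D)∘(id_C⊗Δ_D) = (Δ_D⊗id_C)∘Ψ`. -/
def CP1 (Ψ : C ⊗[k] D →ₗ[k] D ⊗[k] C) : Prop :=
  lTensor D Ψ ∘ₗ (TensorProduct.assoc k D C D).toLinearMap ∘ₗ rTensor D Ψ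
      ∘ₗ (TensorProduct.assoc k C D D).symm.toLinearMap ∘ₗ lTensor C (cmul k D)
    = (TensorProduct.assoc k D D C).toLinearMap ∘ₗ rTensor C (cmul k D) ∘ₗ Ψ

/-- Condition (CP2): `(Ψ⊗id_C)∘(id_C⊗Ψ)∘(Δ_C⊗id_D) = (id_D⊗Δ_C)∘Ψ`. -/
def CP2 (Ψ : C ⊗[k] D →ₗ[k] D ⊗[k] C) : Prop :=
  (TensorProduct.assoc k D C C).toLinearMap ∘ₗ rTensor C Ψ
      ∘ₗ (TensorProduct.assoc k C D C).symm.toLinearMap ∘ₗ lTensor C Ψ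
      ∘ₗ (TensorProduct.assoc k C C D).toLinearMap ∘ₗ rTensor D (cmul k C)
    = lTensor D (cmul k C) ∘ₗ Ψ

/-- The functional `ε_Z := (ε_D⊗ε_C)∘Z`. -/
def epsZ (Z : C ⊗[k] D →ₗ[k] D ⊗[k] C) : C ⊗[k] D →ₗ[k] k :=
  (TensorProduct.lid k k).toLinearMap ∘ₗ map (eps k D) (eps k C) ∘ₗ Z

/-- Right `Z`-conormality: `(ε_Z⊗id_C)∘(id_C⊗Ψ)∘(Δ_C⊗id_D) = id_C⊗ε_D`. -/
def RightZConormal (Ψ Z : C ⊗[k] D →ₗ[k] D ⊗[k] C) : Prop :=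
  (TensorProduct.lid k C).toLinearMap ∘ₗ rTensor C (epsZ Z)
      ∘ₗ (TensorProduct.assoc k C D C).symm.toLinearMap ∘ₗ lTensor C Ψ
      ∘ₗ (TensorProduct.assoc k C C D).toLinearMap ∘ₗ rTensor D (cmul k C)
    = (TensorProduct.rid k C).toLinearMap ∘ₗ lTensor C (eps k D)

/-- Left `Z`-conormality: `(id_D⊗ε_Z)∘(Ψ⊗id_D)∘(id_C⊗Δ_D) = ε_C⊗id_D`. -/
def LeftZConormal (Ψ Z : C ⊗[k] D →ₗ[k] D ⊗[k] C) : Prop :=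
  (TensorProduct.rid k D).toLinearMap ∘ₗ lTensor D (epsZ Z)
      ∘ₗ (TensorProduct.assoc k D C D).toLinearMap ∘ₗ rTensor D Ψ
      ∘ₗ (TensorProduct.assoc k C D D).symm.toLinearMap ∘ₗ lTensor C (cmul k D)
    = (TensorProduct.lid k D).toLinearMap ∘ₗ rTensor D (eps k C)

/-- `Z`-conormality. -/
def ZConormal (Ψ Z : C ⊗[k] D →ₗ[k] D ⊗[k] C) : Prop :=
  RightZConormal Ψ Z ∧ LeftZConormal Ψ Z

/-- The projection `p_C := (id_C⊗e)∘(Δ_C⊗id_D)`. -/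
def pC (e : C ⊗[k] D →ₗ[k] k) : C ⊗[k] D →ₗ[k] C :=
  (TensorProduct.rid k C).toLinearMap ∘ₗ lTensor C e
    ∘ₗ (TensorProduct.assoc k C C D).toLinearMap ∘ₗ rTensor D (cmul k C)

/-- The projection `p_D := (e⊗id_D)∘(id_C⊗Δ_D)`. -/
def pD (e : C ⊗[k] D →ₗ[k] k) : C ⊗[k] D →ₗ[k] D :=
  (TensorProduct.lid k D).toLinearMap ∘ₗ rTensor D e
    ∘ₗ (TensorProduct.assoc k C D D).symm.toLinearMap ∘ₗ lTensor C (cmul k D)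

/-- The projection `π_C = id_C ⊗ ε_D`. -/
def piC : C ⊗[k] D →ₗ[k] C :=
  (TensorProduct.rid k C).toLinearMap ∘ₗ lTensor C (eps k D)

/-- The projection `π_D = ε_C ⊗ id_D`. -/
def piD : C ⊗[k] D →ₗ[k] D :=
  (TensorProduct.lid k D).toLinearMap ∘ₗ rTensor D (eps k C)

/-- Convolution product on `(C⊗D)'`: `(φ∗φ')(c⊗d) = φ(c₁⊗d₁)φ'(c₂⊗d₂)`. -/
def convMul (φ φ' : C ⊗[k] D →ₗ[k] k) : C ⊗[k] D →ₗ[k] k :=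
  (TensorProduct.lid k k).toLinearMap ∘ₗ map φ φ'
    ∘ₗ (tensorTensorTensorComm k C C D D).toLinearMap
    ∘ₗ map (cmul k C) (cmul k D)

/-- `⋆`-product on `(C⊗D)'`: `(φ⋆φ')(c⊗d) = φ(c₂⊗d₁)φ'(c₁⊗d₂)`. -/
def starMul (φ φ' : C ⊗[k] D →ₗ[k] k) : C ⊗[k] D →ₗ[k] k :=
  (TensorProduct.lid k k).toLinearMap ∘ₗ map φ φ'
    ∘ₗ (tensorTensorTensorComm k C C D D).toLinearMap
    ∘ₗ rTensor (D ⊗[k] D) (TensorProduct.comm k C C).toLinearMap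
    ∘ₗ map (cmul k C) (cmul k D)

/-- Condition (LC1): `(Δ_D⊗id_C)∘Ψ' = (id_D⊗Ψ')∘(Δ_D⊗id_C)`. -/
def LC1 (Ψ' : D ⊗[k] C →ₗ[k] D ⊗[k] C) : Prop :=
  (TensorProduct.assoc k D D C).toLinearMap ∘ₗ rTensor C (cmul k D) ∘ₗ Ψ'
    = lTensor D Ψ' ∘ₗ (TensorProduct.assoc k D D C).toLinearMap ∘ₗ rTensor C (cmul k D)

/-- Condition (LC2): `(id_D⊗Δ_C)∘Ψ' = (Ψ'⊗id_C)∘(id_D⊗Δ_C)`. -/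
def LC2 (Ψ' : D ⊗[k] C →ₗ[k] D ⊗[k] C) : Prop :=
  lTensor D (cmul k C) ∘ₗ Ψ'
    = (TensorProduct.assoc k D C C).toLinearMap ∘ₗ rTensor C Ψ'
        ∘ₗ (TensorProduct.assoc k D C C).symm.toLinearMap ∘ₗ lTensor D (cmul k C)

/-- `Ψ' := Ψ ∘ τ`. -/
def psiPrime (Ψ : C ⊗[k] D →ₗ[k] D ⊗[k] C) : D ⊗[k] C →ₗ[k] D ⊗[k] C :=
  Ψ ∘ₗ (TensorProduct.comm k D C).toLinearMap

/-- The twist `Ψ'_φ : d⊗c ↦ φ(c₁⊗d₂) d₁⊗c₂` associated to a functional `φ`. -/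
def PsiPhi (φ : C ⊗[k] D →ₗ[k] k) : D ⊗[k] C →ₗ[k] D ⊗[k] C :=
  (TensorProduct.rid k (D ⊗[k] C)).toLinearMap
    ∘ₗ lTensor (D ⊗[k] C) φ
    ∘ₗ lTensor (D ⊗[k] C) (TensorProduct.comm k D C).toLinearMap
    ∘ₗ (tensorTensorTensorComm k D D C C).toLinearMap
    ∘ₗ lTensor (D ⊗[k] D) (TensorProduct.comm k C C).toLinearMap
    ∘ₗ map (cmul k D) (cmul k C)

/-- The functional `F(Ψ') := (ε_D⊗ε_C)∘Ψ'∘τ` associated to a twist `Ψ' : D⊗C → D⊗C`. -/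
def Ffun (Ψ' : D ⊗[k] C →ₗ[k] D ⊗[k] C) : C ⊗[k] D →ₗ[k] k :=
  (TensorProduct.lid k k).toLinearMap ∘ₗ map (eps k D) (eps k C) ∘ₗ Ψ'
    ∘ₗ (TensorProduct.comm k C D).toLinearMap

/-- The tensor product coproduct `Δ_⊗` on `C ⊗ D`. -/
def tensorComul : C ⊗[k] D →ₗ[k] (C ⊗[k] D) ⊗[k] (C ⊗[k] D) :=
  (tensorTensorTensorComm k C C D D).toLinearMap ∘ₗ map (cmul k C) (cmul k D)

/-- The map `id_C ⊗ Ψ' ⊗ id_D : (C⊗D)⊗(C⊗D) → (C⊗D)⊗(C⊗D)`. -/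
def midMap (Ψ' : D ⊗[k] C →ₗ[k] D ⊗[k] C) :
    (C ⊗[k] D) ⊗[k] (C ⊗[k] D) →ₗ[k] (C ⊗[k] D) ⊗[k] (C ⊗[k] D) :=
  (TensorProduct.assoc k C D (C ⊗[k] D)).symm.toLinearMap
    ∘ₗ lTensor C ((TensorProduct.assoc k D C D).toLinearMap ∘ₗ rTensor D Ψ'
        ∘ₗ (TensorProduct.assoc k D C D).symm.toLinearMap)
    ∘ₗ (TensorProduct.assoc k C D (C ⊗[k] D)).toLinearMap

/-- `C` is co-commutative up to isomorphism: there is a coalgebra isomorphism `C ≅ C^cop`. -/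
def CocommUpToIso (k C : Type*) [CommSemiring k] [AddCommMonoid C] [Module k C]
    [Coalgebra k C] : Prop :=
  ∃ χ : C →ₗ[k] C, Function.Bijective χ ∧
    map χ χ ∘ₗ cmul k C = (TensorProduct.comm k C C).toLinearMap ∘ₗ cmul k C ∘ₗ χ ∧
    eps k C ∘ₗ χ = eps k C

/-- The common value `c ⊗ d ↦ Ψ(c₁ ⊗ d₁) ⊗ Ψ(c₂ ⊗ d₂)` of both sides of (CO), before applying
the coproducts. -/
def doubleTwist (Ψ : C ⊗[k] D →ₗ[k] D ⊗[k] C) :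
    (C ⊗[k] C) ⊗[k] (D ⊗[k] D) →ₗ[k] D ⊗[k] (C ⊗[k] (D ⊗[k] C)) :=
  (TensorProduct.assoc k D C (D ⊗[k] C)).toLinearMap ∘ₗ map Ψ Ψ
    ∘ₗ (tensorTensorTensorComm k C C D D).toLinearMap

/-- The part of the left-hand side of (CO) following `id_C ⊗ Δ_D`. -/
def coLeft (Ψ : C ⊗[k] D →ₗ[k] D ⊗[k] C) :
    (C ⊗[k] D) ⊗[k] D →ₗ[k] D ⊗[k] (C ⊗[k] (D ⊗[k] C)) :=
  lTensor D ((lTensor C Ψ) ∘ₗ (TensorProduct.assoc k C C D).toLinearMap)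
    ∘ₗ lTensor D (rTensor D (cmul k C))
    ∘ₗ (TensorProduct.assoc k D C D).toLinearMap
    ∘ₗ rTensor D Ψ

/-- The part of the right-hand side of (CO) following `Δ_C ⊗ id_D`. -/
def coRight (Ψ : C ⊗[k] D →ₗ[k] D ⊗[k] C) :
    C ⊗[k] (C ⊗[k] D) →ₗ[k] D ⊗[k] (C ⊗[k] (D ⊗[k] C)) :=
  (TensorProduct.assoc k D C (D ⊗[k] C)).toLinearMap
    ∘ₗ rTensor (D ⊗[k] C) Ψ
    ∘ₗ (TensorProduct.assoc k C D (D ⊗[k] C)).symm.toLinearMap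
    ∘ₗ lTensor C (TensorProduct.assoc k D D C).toLinearMap
    ∘ₗ lTensor C (rTensor C (cmul k D))
    ∘ₗ lTensor C Ψ

/-- The part of the twisted coproduct following `Δ_C ⊗ Δ_D`. -/
def twistMiddle (Ψ : C ⊗[k] D →ₗ[k] D ⊗[k] C) :
    (C ⊗[k] C) ⊗[k] (D ⊗[k] D) →ₗ[k] (C ⊗[k] D) ⊗[k] (C ⊗[k] D) :=
  (TensorProduct.assoc k C D (C ⊗[k] D)).symm.toLinearMap
    ∘ₗ lTensor C (TensorProduct.assoc k D C D).toLinearMap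
    ∘ₗ lTensor C (rTensor D Ψ)
    ∘ₗ lTensor C (TensorProduct.assoc k C D D).symm.toLinearMap
    ∘ₗ (TensorProduct.assoc k C C (D ⊗[k] D)).toLinearMap

lemma twistedComul_tmul (Ψ : C ⊗[k] D →ₗ[k] D ⊗[k] C) (c : C) (d : D) :
    twistedComul Ψ (c ⊗ₜ d) = twistMiddle Ψ (cmul k C c ⊗ₜ cmul k D d) := rfl

lemma LC1.comul_apply {Ψ : C ⊗[k] D →ₗ[k] D ⊗[k] C} (h : LC1 (psiPrime Ψ)) (c : C) (d : D) :
    TensorProduct.assoc k D D C (rTensor C (cmul k D) (Ψ (c ⊗ₜ d)))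
      = lTensor D (psiPrime Ψ) (TensorProduct.assoc k D D C (cmul k D d ⊗ₜ c)) :=
  LinearMap.congr_fun h (d ⊗ₜ c)

lemma LC2.comul_apply {Ψ : C ⊗[k] D →ₗ[k] D ⊗[k] C} (h : LC2 (psiPrime Ψ)) (c : C) (d : D) :
    lTensor D (cmul k C) (Ψ (c ⊗ₜ d))
      = TensorProduct.assoc k D C C (rTensor C (psiPrime Ψ)
          ((TensorProduct.assoc k D C C).symm (d ⊗ₜ cmul k C c))) :=
  LinearMap.congr_fun h (d ⊗ₜ c)

lemma lTensor_rTensor_assoc_tmul (f : C →ₗ[k] C ⊗[k] C) (w : D ⊗[k] C) (y : D) :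
    lTensor D (rTensor D f) (TensorProduct.assoc k D C D (w ⊗ₜ y))
      = TensorProduct.assoc k D (C ⊗[k] C) D (lTensor D f w ⊗ₜ y) := by
  induction w with
  | zero => simp
  | add w w' h h' => simp only [add_tmul, map_add, h, h']
  | tmul x c => simp

lemma LC2.coLeft_eq {Ψ : C ⊗[k] D →ₗ[k] D ⊗[k] C} (h : LC2 (psiPrime Ψ)) (c : C)
    (z : D ⊗[k] D) :
    coLeft Ψ ((TensorProduct.assoc k C D D).symm (c ⊗ₜ z))
      = doubleTwist Ψ (cmul k C c ⊗ₜ z) := by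
  induction z with
  | zero => simp
  | add z z' hz hz' => simp only [tmul_add, map_add, hz, hz']
  | tmul x y =>
    simp only [coLeft, doubleTwist, LinearMap.comp_apply, LinearEquiv.coe_coe, assoc_symm_tmul,
      rTensor_tmul, lTensor_rTensor_assoc_tmul, h.comul_apply]
    generalize cmul k C c = u
    induction u with
    | zero => simp
    | add u u' hu hu' => simp only [tmul_add, add_tmul, map_add, hu, hu']
    | tmul a b =>
      simp only [assoc_symm_tmul, rTensor_tmul, tensorTensorTensorComm_tmul, map_tmul, psiPrime,
        LinearMap.comp_apply, LinearEquiv.coe_coe, comm_tmul]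
      generalize Ψ (a ⊗ₜ x) = w
      induction w with
      | zero => simp
      | add w w' hw hw' => simp only [add_tmul, map_add, hw, hw']
      | tmul p q => simp

lemma LC1.coRight_eq {Ψ : C ⊗[k] D →ₗ[k] D ⊗[k] C} (h : LC1 (psiPrime Ψ)) (u : C ⊗[k] C)
    (d : D) :
    coRight Ψ (TensorProduct.assoc k C C D (u ⊗ₜ d))
      = doubleTwist Ψ (u ⊗ₜ cmul k D d) := by
  induction u with
  | zero => simp
  | add u u' hu hu' => simp only [add_tmul, map_add, hu, hu']
  | tmul a b =>
    simp only [coRight, doubleTwist, LinearMap.comp_apply, LinearEquiv.coe_coe, assoc_tmul,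
      lTensor_tmul, h.comul_apply]
    generalize cmul k D d = z
    induction z with
    | zero => simp
    | add z z' hz hz' => simp only [tmul_add, add_tmul, map_add, hz, hz']
    | tmul x y => simp [psiPrime]

/-- Conditions (LC1) and (LC2) imply (CO). -/
lemma condCO_of_LC {Ψ : C ⊗[k] D →ₗ[k] D ⊗[k] C}
    (h1 : LC1 (psiPrime Ψ)) (h2 : LC2 (psiPrime Ψ)) : CondCO Ψ :=
  TensorProduct.ext' fun c d =>
    (h2.coLeft_eq c (cmul k D d)).trans (h1.coRight_eq (cmul k C c) d).symm

/-- The reassociation `a ⊗ ((x ⊗ (b ⊗ (y ⊗ c))) ⊗ z) ↦ (a ⊗ x) ⊗ ((b ⊗ y) ⊗ (c ⊗ z))`. -/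
def regroup (k C D : Type*) [Field k] [AddCommGroup C] [Module k C] [AddCommGroup D]
    [Module k D] :
    C ⊗[k] ((D ⊗[k] (C ⊗[k] (D ⊗[k] C))) ⊗[k] D) →ₗ[k]
      (C ⊗[k] D) ⊗[k] ((C ⊗[k] D) ⊗[k] (C ⊗[k] D)) :=
  (TensorProduct.assoc k C D ((C ⊗[k] D) ⊗[k] (C ⊗[k] D))).symm.toLinearMap
    ∘ₗ lTensor C (lTensor D ((TensorProduct.assoc k (C ⊗[k] D) C D).toLinearMap
        ∘ₗ rTensor D (TensorProduct.assoc k C D C).symm.toLinearMap)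
      ∘ₗ (TensorProduct.assoc k D (C ⊗[k] (D ⊗[k] C)) D).toLinearMap)

/-- The reassociation `(a ⊗ (b ⊗ c)) ⊗ (x ⊗ y) ↦ a ⊗ ((b ⊗ (c ⊗ x)) ⊗ y)`. -/
def regroupRight (k C D : Type*) [Field k] [AddCommGroup C] [Module k C] [AddCommGroup D]
    [Module k D] :
    (C ⊗[k] (C ⊗[k] C)) ⊗[k] (D ⊗[k] D) →ₗ[k] C ⊗[k] ((C ⊗[k] (C ⊗[k] D)) ⊗[k] D) :=
  lTensor C (rTensor D (TensorProduct.assoc k C C D).toLinearMap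
      ∘ₗ (TensorProduct.assoc k (C ⊗[k] C) D D).symm.toLinearMap)
    ∘ₗ (TensorProduct.assoc k C (C ⊗[k] C) (D ⊗[k] D)).toLinearMap

/-- The reassociation `(a ⊗ b) ⊗ ((x ⊗ y) ⊗ z) ↦ a ⊗ (((b ⊗ x) ⊗ y) ⊗ z)`. -/
def regroupLeft (k C D : Type*) [Field k] [AddCommGroup C] [Module k C] [AddCommGroup D]
    [Module k D] :
    (C ⊗[k] C) ⊗[k] ((D ⊗[k] D) ⊗[k] D) →ₗ[k] C ⊗[k] (((C ⊗[k] D) ⊗[k] D) ⊗[k] D) :=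
  lTensor C (rTensor D (TensorProduct.assoc k C D D).symm.toLinearMap
      ∘ₗ (TensorProduct.assoc k C (D ⊗[k] D) D).symm.toLinearMap)
    ∘ₗ (TensorProduct.assoc k C C ((D ⊗[k] D) ⊗[k] D)).toLinearMap

/-- The reassociation `(a ⊗ b) ⊗ (x ⊗ y) ↦ a ⊗ ((b ⊗ x) ⊗ y)`. -/
def regroupMiddle (k C D : Type*) [Field k] [AddCommGroup C] [Module k C] [AddCommGroup D]
    [Module k D] :
    (C ⊗[k] C) ⊗[k] (D ⊗[k] D) →ₗ[k] C ⊗[k] ((C ⊗[k] D) ⊗[k] D) :=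
  lTensor C (TensorProduct.assoc k C D D).symm.toLinearMap
    ∘ₗ (TensorProduct.assoc k C C (D ⊗[k] D)).toLinearMap

lemma assoc_rTensor_twistedComul (Ψ : C ⊗[k] D →ₗ[k] D ⊗[k] C) (u : C ⊗[k] C) (z : D ⊗[k] D) :
    TensorProduct.assoc k (C ⊗[k] D) (C ⊗[k] D) (C ⊗[k] D)
        (rTensor (C ⊗[k] D) (twistedComul Ψ) (twistMiddle Ψ (u ⊗ₜ z)))
      = regroup k C D (lTensor C (rTensor D (coRight Ψ)) (regroupRight k C D
          (TensorProduct.assoc k C C C (rTensor C (cmul k C) u) ⊗ₜ z))) := by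
  induction u with
  | zero => simp
  | add u u' hu hu' => simp only [add_tmul, map_add, hu, hu']
  | tmul a b =>
  induction z with
  | zero => simp
  | add z z' hz hz' => simp only [tmul_add, map_add, hz, hz']
  | tmul x y =>
  have key (v : C ⊗[k] C) : lTensor C (rTensor D (coRight Ψ)) (regroupRight k C D
      (TensorProduct.assoc k C C C (v ⊗ₜ b) ⊗ₜ (x ⊗ₜ y)))
      = lTensor C (rTensor D ((TensorProduct.assoc k D C (D ⊗[k] C)).toLinearMap
          ∘ₗ rTensor (D ⊗[k] C) Ψ
          ∘ₗ (TensorProduct.assoc k C D (D ⊗[k] C)).symm.toLinearMap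
          ∘ₗ lTensor C (TensorProduct.assoc k D D C).toLinearMap
          ∘ₗ lTensor C (rTensor C (cmul k D))))
          (lTensor C (TensorProduct.mk k _ _ |>.flip y)
            (TensorProduct.assoc k C C _ (v ⊗ₜ Ψ (b ⊗ₜ x)))) := by
    induction v with
    | zero => simp
    | add v v' hv hv' => simp only [add_tmul, map_add, hv, hv']
    | tmul p q => simp [regroupRight, coRight]
  rw [rTensor_tmul, key]
  simp only [twistMiddle, LinearMap.comp_apply, LinearEquiv.coe_coe, assoc_tmul, lTensor_tmul,
    assoc_symm_tmul, rTensor_tmul]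
  generalize Ψ (b ⊗ₜ x) = w
  induction w with
  | zero => simp
  | add w w' hw hw' => simp only [add_tmul, tmul_add, map_add, hw, hw']
  | tmul d e =>
  simp only [assoc_tmul, assoc_symm_tmul, rTensor_tmul, twistedComul_tmul]
  generalize cmul k C a = v
  induction v with
  | zero => simp
  | add v v' hv hv' => simp only [add_tmul, map_add, hv, hv']
  | tmul p q =>
  simp only [assoc_tmul, lTensor_tmul, rTensor_tmul, LinearMap.flip_apply, mk_apply,
    LinearMap.comp_apply, LinearEquiv.coe_coe]
  generalize cmul k D d = t
  induction t with
  | zero => simp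
  | add t t' ht ht' => simp only [add_tmul, tmul_add, map_add, ht, ht']
  | tmul f g =>
  simp only [twistMiddle, LinearMap.comp_apply, LinearEquiv.coe_coe, assoc_tmul, lTensor_tmul,
    assoc_symm_tmul, rTensor_tmul]
  generalize Ψ (q ⊗ₜ f) = s
  induction s with
  | zero => simp
  | add s s' hs hs' => simp only [add_tmul, tmul_add, map_add, hs, hs']
  | tmul m n => simp [regroup]

lemma lTensor_twistedComul (Ψ : C ⊗[k] D →ₗ[k] D ⊗[k] C) (u : C ⊗[k] C) (z : D ⊗[k] D) :
    lTensor (C ⊗[k] D) (twistedComul Ψ) (twistMiddle Ψ (u ⊗ₜ z))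
      = regroup k C D (lTensor C (rTensor D (coLeft Ψ)) (regroupLeft k C D
          (u ⊗ₜ (TensorProduct.assoc k D D D).symm (lTensor D (cmul k D) z)))) := by
  induction u with
  | zero => simp
  | add u u' hu hu' => simp only [add_tmul, map_add, hu, hu']
  | tmul a b =>
  induction z with
  | zero => simp
  | add z z' hz hz' => simp only [tmul_add, map_add, hz, hz']
  | tmul x y =>
  have key (v : D ⊗[k] D) : lTensor C (rTensor D (coLeft Ψ)) (regroupLeft k C D
      ((a ⊗ₜ b) ⊗ₜ (TensorProduct.assoc k D D D).symm (x ⊗ₜ v)))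
      = a ⊗ₜ rTensor D (lTensor D ((lTensor C Ψ) ∘ₗ (TensorProduct.assoc k C C D).toLinearMap)
          ∘ₗ lTensor D (rTensor D (cmul k C)) ∘ₗ (TensorProduct.assoc k D C D).toLinearMap)
          ((TensorProduct.assoc k _ D D).symm (Ψ (b ⊗ₜ x) ⊗ₜ v)) := by
    induction v with
    | zero => simp
    | add v v' hv hv' => simp only [tmul_add, map_add, hv, hv']
    | tmul p q => simp [regroupLeft, coLeft]
  rw [lTensor_tmul, key]
  simp only [twistMiddle, LinearMap.comp_apply, LinearEquiv.coe_coe, assoc_tmul, lTensor_tmul,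
    assoc_symm_tmul, rTensor_tmul]
  generalize Ψ (b ⊗ₜ x) = w
  induction w with
  | zero => simp
  | add w w' hw hw' => simp only [add_tmul, tmul_add, map_add, hw, hw']
  | tmul d e =>
  simp only [assoc_tmul, assoc_symm_tmul, lTensor_tmul, twistedComul_tmul]
  generalize cmul k D y = v
  induction v with
  | zero => simp
  | add v v' hv hv' => simp only [tmul_add, map_add, hv, hv']
  | tmul p q =>
  simp only [assoc_tmul, assoc_symm_tmul, lTensor_tmul, rTensor_tmul,
    LinearMap.comp_apply, LinearEquiv.coe_coe]
  generalize cmul k C e = t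
  induction t with
  | zero => simp
  | add t t' ht ht' => simp only [add_tmul, tmul_add, map_add, ht, ht']
  | tmul f g =>
  simp only [twistMiddle, LinearMap.comp_apply, LinearEquiv.coe_coe, assoc_tmul, lTensor_tmul,
    assoc_symm_tmul, rTensor_tmul]
  generalize Ψ (g ⊗ₜ p) = s
  induction s with
  | zero => simp
  | add s s' hs hs' => simp only [add_tmul, tmul_add, map_add, hs, hs']
  | tmul m n => simp [regroup]

lemma lTensor_coRight_regroupRight (Ψ : C ⊗[k] D →ₗ[k] D ⊗[k] C) (u : C ⊗[k] C)
    (z : D ⊗[k] D) :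
    lTensor C (rTensor D (coRight Ψ)) (regroupRight k C D (lTensor C (cmul k C) u ⊗ₜ z))
      = lTensor C (rTensor D (COrhs Ψ)) (regroupMiddle k C D (u ⊗ₜ z)) := by
  induction u with
  | zero => simp
  | add u u' hu hu' => simp only [add_tmul, map_add, hu, hu']
  | tmul a b =>
  induction z with
  | zero => simp
  | add z z' hz hz' => simp only [tmul_add, map_add, hz, hz']
  | tmul x y => simp [regroupRight, regroupMiddle, coRight, COrhs]

lemma lTensor_coLeft_regroupLeft (Ψ : C ⊗[k] D →ₗ[k] D ⊗[k] C) (u : C ⊗[k] C)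
    (z : D ⊗[k] D) :
    lTensor C (rTensor D (coLeft Ψ)) (regroupLeft k C D (u ⊗ₜ rTensor D (cmul k D) z))
      = lTensor C (rTensor D (COlhs Ψ)) (regroupMiddle k C D (u ⊗ₜ z)) := by
  induction u with
  | zero => simp
  | add u u' hu hu' => simp only [add_tmul, map_add, hu, hu']
  | tmul a b =>
  induction z with
  | zero => simp
  | add z z' hz hz' => simp only [tmul_add, map_add, hz, hz']
  | tmul x y => simp [regroupLeft, regroupMiddle, coLeft, COlhs]

/-- Condition (CO) implies that the twisted coproduct is coassociative. -/
lemma CondCO.coassoc {Ψ : C ⊗[k] D →ₗ[k] D ⊗[k] C} (h : CondCO Ψ) :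
    (TensorProduct.assoc k (C ⊗[k] D) (C ⊗[k] D) (C ⊗[k] D)).toLinearMap
        ∘ₗ rTensor (C ⊗[k] D) (twistedComul Ψ) ∘ₗ twistedComul Ψ
      = lTensor (C ⊗[k] D) (twistedComul Ψ) ∘ₗ twistedComul Ψ := by
  refine TensorProduct.ext' fun c d => ?_
  have hC : TensorProduct.assoc k C C C (rTensor C (cmul k C) (cmul k C c))
      = lTensor C (cmul k C) (cmul k C c) := Coalgebra.coassoc_apply c
  have hD : (TensorProduct.assoc k D D D).symm (lTensor D (cmul k D) (cmul k D d))
      = rTensor D (cmul k D) (cmul k D d) := Coalgebra.coassoc_symm_apply d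
  have hCO : COlhs Ψ = COrhs Ψ := h
  simp only [LinearMap.comp_apply, LinearEquiv.coe_coe, twistedComul_tmul]
  rw [assoc_rTensor_twistedComul, lTensor_twistedComul, hC, hD, lTensor_coRight_regroupRight,
    lTensor_coLeft_regroupLeft, hCO]

theorem stmt11 (Ψ : C ⊗[k] D →ₗ[k] D ⊗[k] C)
    (h1 : LC1 (psiPrime Ψ)) (h2 : LC2 (psiPrime Ψ)) :
    CondCO Ψ ∧
    (TensorProduct.assoc k (C ⊗[k] D) (C ⊗[k] D) (C ⊗[k] D)).toLinearMap
        ∘ₗ rTensor (C ⊗[k] D) (twistedComul Ψ) ∘ₗ twistedComul Ψ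
      = lTensor (C ⊗[k] D) (twistedComul Ψ) ∘ₗ twistedComul Ψ :=
  have h := condCO_of_LC h1 h2
  ⟨h, h.coassoc⟩

end TwistedTensor
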